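/- arXiv:math/0611293 — 5 statements merged into one kernel-verified Lean document; each statement's English description precedes it below -/
import Mathlib

section
/- If f is a polynomial with nonnegative integer coefficients and b is an integer with b ≥ 10, then (f(10)) _ b ≥ f(b). -/
/-- The dungeon operation: interpret the base-10 digits of `a` in base `b`. -/
def dungeon (a b : ℕ) : ℕ := Nat.ofDigits b (Nat.digits 10 a)

theorem dungeon_eq_mod_add_mul_div (a b : ℕ) :
    dungeon a b = a % 10 + b * dungeon (a / 10) b := by
  rcases eq_or_ne a 0 with rfl | ha
  · simp [dungeon]
  · simp [dungeon, Nat.digits_eq_cons_digits_div (by norm_num : 1 < 10) ha, Nat.ofDigits_cons]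

theorem dungeon_mul_ten_pow (a b k : ℕ) : dungeon (a * 10 ^ k) b = dungeon a b * b ^ k := by
  induction k with
  | zero => simp
  | succ k ih =>
    rw [dungeon_eq_mod_add_mul_div, pow_succ, ← mul_assoc, Nat.mul_mod_left,
      Nat.mul_div_cancel _ (by norm_num), ih]
    ring

theorem le_dungeon (a : ℕ) {b : ℕ} (hb : 10 ≤ b) : a ≤ dungeon a b := by
  conv_lhs => rw [← Nat.ofDigits_digits 10 a]
  exact Nat.ofDigits_monotone _ hb

theorem dungeon_add_le {b : ℕ} (hb : 10 ≤ b) (m n : ℕ) :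
    dungeon m b + dungeon n b ≤ dungeon (m + n) b := by
  induction h : m + n using Nat.strong_induction_on generalizing m n with
  | _ s ih =>
    subst h
    rcases Nat.eq_zero_or_pos (m + n) with h0 | hpos
    · obtain ⟨rfl, rfl⟩ : m = 0 ∧ n = 0 := by omega
      simp [dungeon]
    have hdiv := ih _ (by omega) (m / 10) (n / 10) rfl
    rw [dungeon_eq_mod_add_mul_div m, dungeon_eq_mod_add_mul_div n,
      dungeon_eq_mod_add_mul_div (m + n)]
    by_cases hc : m % 10 + n % 10 < 10
    · rw [show (m + n) % 10 = m % 10 + n % 10 by omega,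
        show (m + n) / 10 = m / 10 + n / 10 by omega]
      nlinarith
    · have hone := ih _ (by omega) (m / 10 + n / 10) 1 rfl
      rw [show dungeon 1 b = 1 by simp [dungeon]] at hone
      rw [show (m + n) / 10 = m / 10 + n / 10 + 1 by omega]
      have hmod : m % 10 + n % 10 = (m + n) % 10 + 10 := by omega
      nlinarith

theorem dungeon_eval_ge (f : Polynomial ℕ) (b : ℕ) (hb : 10 ≤ b) :
    f.eval b ≤ dungeon (f.eval 10) b := by
  induction f using Polynomial.induction_on' with
  | add p q hp hq =>
    rw [Polynomial.eval_add, Polynomial.eval_add]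
    exact (add_le_add hp hq).trans (dungeon_add_le hb _ _)
  | monomial k a =>
    rw [Polynomial.eval_monomial, Polynomial.eval_monomial, dungeon_mul_ten_pow]
    exact Nat.mul_le_mul_right _ (le_dungeon a hb)
end

section
/- Let a, b, c be integers, each at least 10. Then (a _ b) _ c ≥ a _ (b _ c). -/
theorem dungeon_zero_left (c : ℕ) : dungeon 0 c = 0 := by
  simp [dungeon]

theorem dungeon_eq (n c : ℕ) : dungeon n c = n % 10 + c * dungeon (n / 10) c := by
  rcases Nat.eq_zero_or_pos n with rfl | hn
  · simp [dungeon]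
  · conv_lhs => rw [dungeon, Nat.digits_def' (by norm_num) hn, Nat.ofDigits_cons]
    simp [dungeon]

theorem dungeon_of_lt {d : ℕ} (c : ℕ) (hd : d < 10) : dungeon d c = d := by
  rw [dungeon_eq, Nat.mod_eq_of_lt hd, Nat.div_eq_of_lt hd, dungeon_zero_left, mul_zero, add_zero]

theorem dungeon_ten_mul (n c : ℕ) : dungeon (10 * n) c = c * dungeon n c := by
  rw [dungeon_eq, Nat.mul_mod_right, Nat.mul_div_cancel_left n (by norm_num), zero_add]

theorem dungeon_add_one_le {c : ℕ} (hc : 10 ≤ c) (n : ℕ) :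
    dungeon n c + 1 ≤ dungeon (n + 1) c := by
  induction n using Nat.strong_induction_on with
  | _ n ih =>
    rw [dungeon_eq n, dungeon_eq (n + 1)]
    by_cases h : n % 10 = 9
    · have hdiv : (n + 1) / 10 = n / 10 + 1 := by omega
      have hstep := Nat.mul_le_mul_left c (ih (n / 10) (by omega))
      rw [mul_add, mul_one] at hstep
      rw [hdiv]
      omega
    · have hdiv : (n + 1) / 10 = n / 10 := by omega
      rw [hdiv]
      omega

theorem dungeon_add_le_s7 {c : ℕ} (hc : 10 ≤ c) (x y : ℕ) :
    dungeon x c + dungeon y c ≤ dungeon (x + y) c := by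
  induction x using Nat.strong_induction_on generalizing y with
  | _ x ih =>
    rcases Nat.eq_zero_or_pos x with rfl | hx
    · simp [dungeon_zero_left]
    rw [dungeon_eq x, dungeon_eq y, dungeon_eq (x + y)]
    have hsum := ih (x / 10) (by omega) (y / 10)
    by_cases h : x % 10 + y % 10 < 10
    · have hdiv : (x + y) / 10 = x / 10 + y / 10 := by omega
      have hmul := Nat.mul_le_mul_left c hsum
      rw [mul_add] at hmul
      rw [hdiv]
      omega
    · have hdiv : (x + y) / 10 = x / 10 + y / 10 + 1 := by omega
      have hmul := Nat.mul_le_mul_left c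
        ((Nat.add_le_add_right hsum 1).trans (dungeon_add_one_le hc _))
      rw [mul_add, mul_add, mul_one] at hmul
      rw [hdiv]
      omega

theorem mul_dungeon_le {c : ℕ} (hc : 10 ≤ c) (d y : ℕ) :
    d * dungeon y c ≤ dungeon (d * y) c := by
  induction d with
  | zero => simp
  | succ d ih =>
    rw [add_mul, add_mul, one_mul, one_mul]
    exact (Nat.add_le_add_right ih _).trans (dungeon_add_le_s7 hc _ _)

theorem dungeon_mul_le {c : ℕ} (hc : 10 ≤ c) (x y : ℕ) :
    dungeon x c * dungeon y c ≤ dungeon (x * y) c := by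
  induction x using Nat.strong_induction_on with
  | _ x ih =>
    rcases Nat.eq_zero_or_pos x with rfl | hx
    · simp [dungeon_zero_left]
    calc dungeon x c * dungeon y c
        = x % 10 * dungeon y c + c * (dungeon (x / 10) c * dungeon y c) := by
          rw [dungeon_eq x]; ring
      _ ≤ dungeon (x % 10 * y) c + c * dungeon (x / 10 * y) c :=
          Nat.add_le_add (mul_dungeon_le hc _ _)
            (Nat.mul_le_mul_left c (ih (x / 10) (by omega)))
      _ = dungeon (x % 10 * y) c + dungeon (10 * (x / 10 * y)) c := by rw [dungeon_ten_mul]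
      _ ≤ dungeon (x % 10 * y + 10 * (x / 10 * y)) c := dungeon_add_le_s7 hc _ _
      _ = dungeon (x * y) c := by rw [← mul_assoc, ← add_mul, Nat.mod_add_div]

theorem dungeon_dungeon_le {c : ℕ} (hc : 10 ≤ c) (a b : ℕ) :
    dungeon a (dungeon b c) ≤ dungeon (dungeon a b) c := by
  induction a using Nat.strong_induction_on with
  | _ a ih =>
    rcases Nat.eq_zero_or_pos a with rfl | ha
    · simp [dungeon_zero_left]
    calc dungeon a (dungeon b c)
        = a % 10 + dungeon b c * dungeon (a / 10) (dungeon b c) := dungeon_eq _ _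
      _ ≤ dungeon (a % 10) c + dungeon b c * dungeon (dungeon (a / 10) b) c :=
          Nat.add_le_add (dungeon_of_lt c (Nat.mod_lt a (by norm_num))).ge
            (Nat.mul_le_mul_left _ (ih (a / 10) (by omega)))
      _ ≤ dungeon (a % 10) c + dungeon (b * dungeon (a / 10) b) c :=
          Nat.add_le_add_left (dungeon_mul_le hc _ _) _
      _ ≤ dungeon (a % 10 + b * dungeon (a / 10) b) c := dungeon_add_le_s7 hc _ _
      _ = dungeon (dungeon a b) c := by rw [← dungeon_eq a b]

theorem dungeon_assoc_ineq (a b c : ℕ) (ha : 10 ≤ a) (hb : 10 ≤ b) (hc : 10 ≤ c) :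
    dungeon a (dungeon b c) ≤ dungeon (dungeon a b) c := by
  exact dungeon_dungeon_le hc a b
end

section
/- Let a and b be integers, each at least 10, and let log denote the logarithm to base 10. Then 10^(⌊log a⌋·⌊log b⌋) ≤ 10^(⌊log a⌋·log b) ≤ a _ b ≤ 10^((log a)·(log b)), where the exponentials are real powers of 10. -/
open Real

theorem ofDigits_rpow_le_rpow_ofDigits {L : ℝ} (hL : 1 ≤ L) {b c : ℕ}
    (hb : (b : ℝ) = (c : ℝ) ^ L) (l : List ℕ) :
    ((Nat.ofDigits b l : ℕ) : ℝ) ≤ ((Nat.ofDigits c l : ℕ) : ℝ) ^ L := by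
  induction l with
  | nil => simp [Real.zero_rpow (by linarith : L ≠ 0)]
  | cons d l ih =>
    have hd : (d : ℝ) ≤ (d : ℝ) ^ L := by
      rcases Nat.eq_zero_or_pos d with rfl | hd
      · simp [Real.zero_rpow (by linarith : L ≠ 0)]
      · exact Real.self_le_rpow_of_one_le (by exact_mod_cast hd) hL
    have hsuper := Real.add_rpow_le_rpow_add (Nat.cast_nonneg (α := ℝ) d)
      (Nat.cast_nonneg (α := ℝ) (c * Nat.ofDigits c l)) hL
    have hmul : (b : ℝ) * (Nat.ofDigits b l : ℕ) ≤ ((c * Nat.ofDigits c l : ℕ) : ℝ) ^ L := by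
      rw [Nat.cast_mul, Real.mul_rpow (by positivity) (by positivity), ← hb]
      gcongr
    simp only [Nat.ofDigits_cons]
    push_cast at hsuper hmul ⊢
    linarith

theorem pow_log_le_dungeon {a b : ℕ} (ha : a ≠ 0) (hb : 2 ≤ b) :
    b ^ Nat.log 10 a ≤ dungeon a b := by
  obtain ⟨b, rfl⟩ := Nat.exists_eq_add_of_le' hb
  have h := Nat.pow_length_le_mul_ofDigits (b := b)
    (Nat.digits_ne_nil_iff_ne_zero.mpr ha) (Nat.getLast_digit_ne_zero 10 ha)
  rw [Nat.length_digits 10 a (by norm_num) ha, pow_succ'] at h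
  exact Nat.le_of_mul_le_mul_left h (by lia)

theorem dungeon_log_bounds (a b : ℕ) (ha : 10 ≤ a) (hb : 10 ≤ b) :
    (10 : ℝ) ^ (((⌊logb 10 a⌋ * ⌊logb 10 b⌋ : ℤ) : ℝ)) ≤
        (10 : ℝ) ^ ((⌊logb 10 a⌋ : ℝ) * logb 10 b) ∧
      (10 : ℝ) ^ ((⌊logb 10 a⌋ : ℝ) * logb 10 b) ≤ (dungeon a b : ℝ) ∧
      (dungeon a b : ℝ) ≤ (10 : ℝ) ^ (logb 10 a * logb 10 b) := by
  have ha' : (0 : ℝ) < a := by exact_mod_cast (by lia : 0 < a)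
  have hb' : (0 : ℝ) < b := by exact_mod_cast (by lia : 0 < b)
  have hpow : (10 : ℝ) ^ logb 10 (b : ℝ) = b :=
    Real.rpow_logb (by norm_num) (by norm_num) hb'
  have hfloor : ⌊logb 10 (a : ℝ)⌋ = (Nat.log 10 a : ℤ) := by
    have := Real.floor_logb_natCast (b := 10) (r := (a : ℝ)) ha'.le
    rw [Int.log_natCast] at this
    exact_mod_cast this
  have hL : 1 ≤ logb 10 (b : ℝ) := by
    rw [Real.le_logb_iff_rpow_le (by norm_num) hb', Real.rpow_one]
    exact_mod_cast hb
  refine ⟨?_, ?_, ?_⟩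
  · rw [hfloor]
    push_cast
    gcongr
    · norm_num
    · exact Int.floor_le _
  · rw [hfloor, mul_comm, Real.rpow_mul (by norm_num), hpow, Int.cast_natCast, Real.rpow_natCast]
    exact_mod_cast pow_log_le_dungeon (by lia : a ≠ 0) (by lia : 2 ≤ b)
  · rw [Real.rpow_mul (by norm_num), Real.rpow_logb (by norm_num) (by norm_num) ha']
    have h := ofDigits_rpow_le_rpow_ofDigits hL (b := b) (c := 10)
      (by exact_mod_cast hpow.symm) (Nat.digits 10 a)
    rw [Nat.ofDigits_digits] at h
    exact h
end

section
/- For n ≥ 10 let α(n) = 10 _ (11 _ (12 _ (⋯ _ n))) be the top-down-parenthesized dungeon; formally, α(n) = f(10, n) where f(n, n) = n and f(k, n) = k _ f(k+1, n) for 10 ≤ k < n. Then log log α(n) is asymptotic to n · log log n as n → ∞; that is, the ratio (log log α(n)) / (n · log log n) tends to 1, where log denotes the logarithm to base 10. -/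
open Real Filter

lemma dungeon_of_lt_ten {a : ℕ} (b : ℕ) (ha : 0 < a) (h : a < 10) : dungeon a b = a := by
  rw [dungeon, Nat.digits_of_lt 10 a ha.ne' h]
  simp

lemma dungeon_eq_mod_add_mul {a : ℕ} (b : ℕ) (ha : 0 < a) :
    dungeon a b = a % 10 + b * dungeon (a / 10) b := by
  rw [dungeon, Nat.digits_def' (by norm_num) ha, Nat.ofDigits_cons, dungeon]

lemma pow_log_le_dungeon_and_dungeon_lt {b : ℕ} (hb : 10 ≤ b) (a : ℕ) (ha : 0 < a) :
    b ^ Nat.log 10 a ≤ dungeon a b ∧ dungeon a b + 1 ≤ 10 * b ^ Nat.log 10 a := by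
  induction a using Nat.strong_induction_on with
  | _ a ih =>
    by_cases h : a < 10
    · rw [dungeon_of_lt_ten b ha h, Nat.log_of_lt h, pow_zero]
      omega
    · obtain ⟨h1, h2⟩ := ih (a / 10) (by omega) (by omega)
      rw [dungeon_eq_mod_add_mul b ha, Nat.log_of_one_lt_of_le (by norm_num) (by omega), pow_succ]
      have hr : a % 10 < 10 := Nat.mod_lt _ (by norm_num)
      have h3 := Nat.mul_le_mul_left b h1
      have h4 := Nat.mul_le_mul_left b h2
      refine ⟨(mul_comm _ b).trans_le (h3.trans (Nat.le_add_left _ _)), ?_⟩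
      nlinarith

lemma logb_dungeon_bounds {a b : ℕ} (ha : 0 < a) (hb : 10 ≤ b) :
    Nat.log 10 a * logb 10 b ≤ logb 10 (dungeon a b) ∧
      logb 10 (dungeon a b) ≤ Nat.log 10 a * logb 10 b + 1 := by
  obtain ⟨h1, h2⟩ := pow_log_le_dungeon_and_dungeon_lt hb a ha
  have hb0 : (0 : ℝ) < b := by positivity
  have hpow : (0 : ℝ) < (b : ℝ) ^ Nat.log 10 a := by positivity
  have h1' : (b : ℝ) ^ Nat.log 10 a ≤ dungeon a b := by exact_mod_cast h1
  have h2' : (dungeon a b : ℝ) ≤ (b : ℝ) ^ Nat.log 10 a * 10 := by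
    have : dungeon a b ≤ b ^ Nat.log 10 a * 10 := by omega
    exact_mod_cast this
  constructor
  · rw [← logb_pow]
    exact logb_le_logb_of_le (by norm_num) hpow h1'
  · calc logb 10 (dungeon a b) ≤ logb 10 ((b : ℝ) ^ Nat.log 10 a * 10) :=
          logb_le_logb_of_le (by norm_num) (hpow.trans_le h1') h2'
      _ = Nat.log 10 a * logb 10 b + 1 := by
          rw [logb_mul hpow.ne' (by norm_num), logb_pow, logb_self_eq_one (by norm_num)]

lemma one_le_logb_ten {b : ℕ} (hb : 10 ≤ b) : 1 ≤ logb 10 (b : ℝ) := by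
  rw [le_logb_iff_rpow_le (by norm_num) (by positivity)]
  simpa using (by exact_mod_cast hb : (10 : ℝ) ≤ b)

lemma one_le_log_ten {k : ℕ} (hk : 10 ≤ k) : 1 ≤ Nat.log 10 k :=
  Nat.log_pos (by norm_num) hk

lemma dungeon_tower_bounds {f : ℕ → ℕ → ℕ} (hdiag : ∀ n, f n n = n)
    (hstep : ∀ k n, 10 ≤ k → k < n → f k n = dungeon k (f (k + 1) n))
    {n k : ℕ} (hk : 10 ≤ k) (hkn : k ≤ n) :
    10 ≤ f k n ∧
      (∏ i ∈ Finset.Ico k n, (Nat.log 10 i : ℝ)) * logb 10 n ≤ logb 10 (f k n) ∧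
      logb 10 (f k n) + 1 ≤
        (∏ i ∈ Finset.Ico k n, (Nat.log 10 i : ℝ)) * (logb 10 n + 1) + (100 - k : ℕ) := by
  induction hkn using Nat.decreasingInduction with
  | self =>
    rw [hdiag]
    simp [hk]
  | of_succ k hkn ih =>
    obtain ⟨h10, hlo, hhi⟩ := ih (by omega)
    have he := one_le_log_ten hk
    have heR : (1 : ℝ) ≤ Nat.log 10 k := by exact_mod_cast he
    obtain ⟨d1, d2⟩ := logb_dungeon_bounds (a := k) (by omega) h10
    rw [hstep k n hk hkn, Finset.prod_eq_prod_Ico_succ_bot hkn]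
    refine ⟨?_, ?_, ?_⟩
    · exact (h10.trans (Nat.le_self_pow (by omega) _)).trans
        (pow_log_le_dungeon_and_dungeon_lt h10 k (by omega)).1
    · rw [mul_assoc]
      exact (mul_le_mul_of_nonneg_left hlo (by positivity)).trans d1
    · rw [mul_assoc]
      by_cases h : k < 100
      · have : Nat.log 10 k = 1 := by
          rw [Nat.log_eq_iff (by norm_num)]
          omega
        rw [this] at d2 ⊢
        have hs : 100 - k = (100 - (k + 1)) + 1 := by omega
        rw [hs]
        push_cast at *
        linarith
      · have h2 : (2 : ℝ) ≤ Nat.log 10 k := by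
          exact_mod_cast Nat.le_log_of_pow_le (by norm_num) (by omega)
        have hs : 100 - (k + 1) = 0 := by omega
        have hs' : 100 - k = 0 := by omega
        rw [hs] at hhi
        rw [hs']
        push_cast at *
        nlinarith [mul_le_mul_of_nonneg_left hhi (by positivity : (0 : ℝ) ≤ Nat.log 10 k)]

lemma sum_logb_log_le {n : ℕ} (hn : 10 ≤ n) :
    ∑ i ∈ Finset.Ico 10 n, logb 10 (Nat.log 10 i : ℝ) ≤ (n - 10 : ℝ) * logb 10 (logb 10 n) := by
  have key : ∀ i ∈ Finset.Ico 10 n, logb 10 (Nat.log 10 i : ℝ) ≤ logb 10 (logb 10 n) := by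
    intro i hi
    rw [Finset.mem_Ico] at hi
    have hi1 := one_le_log_ten hi.1
    refine logb_le_logb_of_le (by norm_num) (by exact_mod_cast hi1) ?_
    rw [le_logb_iff_rpow_le (by norm_num) (by positivity), rpow_natCast]
    exact_mod_cast (Nat.pow_log_le_self 10 (by omega)).trans hi.2.le
  have := Finset.sum_le_card_nsmul _ _ _ key
  rw [Nat.card_Ico, nsmul_eq_mul, Nat.cast_sub hn] at this
  exact_mod_cast this

lemma le_sum_logb_log {n : ℕ} (hn : 10000 ≤ n) :
    (n - √n - 1) * (logb 10 (logb 10 n) - logb 10 4) ≤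
      ∑ i ∈ Finset.Ico 10 n, logb 10 (Nat.log 10 i : ℝ) := by
  have hs : 10 ≤ Nat.sqrt n + 1 := (Nat.le_sqrt.2 (by omega) : 10 ≤ Nat.sqrt n).trans (by omega)
  have hsn : Nat.sqrt n + 1 ≤ n := Nat.sqrt_lt_self (by omega)
  have hL : 4 ≤ logb 10 (n : ℝ) := by
    rw [le_logb_iff_rpow_le (by norm_num) (by positivity)]
    norm_num
    exact_mod_cast hn
  have key : ∀ i ∈ Finset.Ico (Nat.sqrt n + 1) n,
      logb 10 (logb 10 n) - logb 10 4 ≤ logb 10 (Nat.log 10 i : ℝ) := by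
    intro i hi
    rw [Finset.mem_Ico] at hi
    rw [← logb_div (by linarith) (by norm_num)]
    refine logb_le_logb_of_le (by norm_num) (by linarith) ?_
    have h1 : (n : ℝ) ≤ (i : ℝ) ^ 2 := by
      exact_mod_cast (Nat.sqrt_lt'.1 (by omega : Nat.sqrt n < i)).le
    have h2 : (i : ℝ) ≤ 10 ^ (Nat.log 10 i + 1) := by
      exact_mod_cast (Nat.lt_pow_succ_log_self (by norm_num) i).le
    have hn0 : (0 : ℝ) < n := by positivity
    have hi0 : (0 : ℝ) < i := by exact_mod_cast (by omega : 0 < i)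
    have h3 := logb_le_logb_of_le (b := 10) (by norm_num) hn0 h1
    have h4 := logb_le_logb_of_le (b := 10) (by norm_num) hi0 h2
    rw [logb_pow] at h3 h4
    rw [logb_self_eq_one (by norm_num)] at h4
    push_cast at h3 h4
    linarith
  have hcard := Finset.card_nsmul_le_sum _ _ _ key
  rw [Nat.card_Ico, nsmul_eq_mul, Nat.cast_sub hsn] at hcard
  have hnn : 0 ≤ logb 10 (logb 10 (n : ℝ)) - logb 10 4 :=
    sub_nonneg.2 (logb_le_logb_of_le (by norm_num) (by norm_num) hL)
  calc (n - √n - 1) * (logb 10 (logb 10 n) - logb 10 4)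
      ≤ ((n : ℝ) - (Nat.sqrt n + 1 : ℕ)) * (logb 10 (logb 10 n) - logb 10 4) := by
        refine mul_le_mul_of_nonneg_right ?_ hnn
        have := Real.nat_sqrt_le_real_sqrt (a := n)
        push_cast
        linarith
    _ ≤ _ := hcard
    _ ≤ _ := by
        refine Finset.sum_le_sum_of_subset_of_nonneg
          (Finset.Ico_subset_Ico_left hs) fun i hi _ => logb_nonneg (by norm_num) ?_
        exact_mod_cast one_le_log_ten (Finset.mem_Ico.1 hi).1

lemma loglog_dungeon_tower_bounds {f : ℕ → ℕ → ℕ} (hdiag : ∀ n, f n n = n)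
    (hstep : ∀ k n, 10 ≤ k → k < n → f k n = dungeon k (f (k + 1) n))
    {n : ℕ} (hn : 10000 ≤ n) :
    (n - √n - 1) * (logb 10 (logb 10 n) - logb 10 4) ≤ logb 10 (logb 10 (f 10 n)) ∧
      logb 10 (logb 10 (f 10 n)) ≤ n * logb 10 (logb 10 n) + logb 10 92 := by
  obtain ⟨h10, hlo, hhi⟩ := dungeon_tower_bounds hdiag hstep le_rfl (by omega : 10 ≤ n)
  set P := ∏ i ∈ Finset.Ico 10 n, (Nat.log 10 i : ℝ) with hP
  have hfac : ∀ i ∈ Finset.Ico 10 n, (1 : ℝ) ≤ Nat.log 10 i := fun i hi => by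
    exact_mod_cast one_le_log_ten (Finset.mem_Ico.1 hi).1
  have hP1 : 1 ≤ P := by
    rw [hP, ← Finset.prod_const_one (s := Finset.Ico 10 n)]
    exact Finset.prod_le_prod (fun _ _ => zero_le_one) hfac
  have hlogP : logb 10 P = ∑ i ∈ Finset.Ico 10 n, logb 10 (Nat.log 10 i : ℝ) :=
    logb_prod _ _ fun i hi => (zero_lt_one.trans_le (hfac i hi)).ne'
  have hL : 1 ≤ logb 10 (n : ℝ) := one_le_logb_ten (by omega)
  have hLL : 0 ≤ logb 10 (logb 10 (n : ℝ)) := logb_nonneg (by norm_num) hL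
  have hf : 1 ≤ logb 10 (f 10 n : ℝ) := one_le_logb_ten h10
  constructor
  · have h := logb_le_logb_of_le (b := 10) (by norm_num) (by positivity) hlo
    rw [logb_mul (by positivity) (by positivity), hlogP] at h
    linarith [le_sum_logb_log hn]
  · have hle : logb 10 (f 10 n : ℝ) ≤ P * logb 10 n * 92 := by
      norm_num at hhi
      nlinarith [mul_le_mul_of_nonneg_left hL (zero_le_one.trans hP1)]
    have h := logb_le_logb_of_le (b := 10) (by norm_num) (by positivity) hle
    rw [logb_mul (by positivity) (by norm_num), logb_mul (by positivity) (by positivity),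
      hlogP] at h
    linarith [sum_logb_log_le (by omega : 10 ≤ n)]

theorem alpha_loglog_asymptotic (f : ℕ → ℕ → ℕ) (α : ℕ → ℕ)
    (hdiag : ∀ n, f n n = n)
    (hstep : ∀ k n, 10 ≤ k → k < n → f k n = dungeon k (f (k + 1) n))
    (hα : ∀ n, 10 ≤ n → α n = f 10 n) :
    Tendsto (fun n : ℕ =>
        logb 10 (logb 10 (α n)) / (n * logb 10 (logb 10 n))) atTop (nhds 1) := by
  have hn : Tendsto (fun n : ℕ => (n : ℝ)) atTop atTop := tendsto_natCast_atTop_atTop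
  have hlogb : Tendsto (logb 10) atTop atTop := tendsto_logb_atTop (by norm_num)
  have hLL : Tendsto (fun n : ℕ => logb 10 (logb 10 (n : ℝ))) atTop atTop :=
    hlogb.comp (hlogb.comp hn)
  have hsqrt : Tendsto (fun n : ℕ => √(n : ℝ)) atTop atTop := tendsto_sqrt_atTop.comp hn
  have hlower : Tendsto (fun n : ℕ => (1 - 1 / √(n : ℝ) - 1 / (n : ℝ)) *
      (1 - logb 10 4 / logb 10 (logb 10 (n : ℝ)))) atTop (nhds 1) := by
    simpa using (((tendsto_const_nhds (x := (1 : ℝ))).sub (hsqrt.const_div_atTop 1)).sub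
      (hn.const_div_atTop 1)).mul
      ((tendsto_const_nhds (x := (1 : ℝ))).sub (hLL.const_div_atTop (logb 10 4)))
  have hupper : Tendsto (fun n : ℕ => 1 + logb 10 92 / (n * logb 10 (logb 10 (n : ℝ))))
      atTop (nhds 1) := by
    simpa using (tendsto_const_nhds (x := (1 : ℝ))).add
      ((hn.atTop_mul_atTop₀ hLL).const_div_atTop (logb 10 92))
  refine tendsto_of_tendsto_of_tendsto_of_le_of_le' hlower hupper ?_ ?_
  all_goals
    filter_upwards [eventually_ge_atTop 10000, hLL.eventually_gt_atTop 0] with n hn hpos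
    obtain ⟨hlo, hhi⟩ := loglog_dungeon_tower_bounds hdiag hstep hn
    have hn0 : (0 : ℝ) < n := by positivity
    rw [hα n (by omega)]
  · rw [le_div_iff₀ (by positivity)]
    refine le_of_eq_of_le ?_ hlo
    have hs : (1 : ℝ) / √n = √n / n := by rw [Real.sqrt_div_self', one_div]
    rw [hs]
    field_simp
  · rw [div_le_iff₀ (by positivity)]
    refine hhi.trans_eq ?_
    field_simp
end

section
/- Let α be the sequence defined for n ≥ 10 by α(n) = f(10, n), where f(n, n) = n and f(k, n) = k _ f(k+1, n) for 10 ≤ k < n. Then α converges 10-adically: for every natural number k there exists N such that for all m, n ≥ N, α(m) ≡ α(n) (mod 10^k). -/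
theorem dungeon_modEq (a : ℕ) {b c M : ℕ} (h : b ≡ c [MOD M]) :
    dungeon a b ≡ dungeon a c [MOD M] :=
  Nat.ofDigits_modEq' b c M h _

theorem dungeon_mul_ten_pow_s18 {c : ℕ} (hc : 0 < c) (hc' : c < 10) (r b : ℕ) :
    dungeon (c * 10 ^ r) b = c * b ^ r := by
  rw [dungeon, mul_comm, Nat.digits_base_pow_mul (by norm_num) hc, Nat.ofDigits_append,
    Nat.digits_of_lt 10 c hc.ne' hc']
  simp [Nat.ofDigits_replicate_zero, mul_comm]

theorem dungeon_mul_ten_pow_modEq {c : ℕ} (hc : 0 < c) (hc' : c < 10) (r : ℕ) {x y M : ℕ}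
    (h : x ≡ y [MOD M]) :
    dungeon (c * 10 ^ r) x ≡ dungeon (c * 10 ^ r) y [MOD c * M] := by
  rw [dungeon_mul_ten_pow_s18 hc hc', dungeon_mul_ten_pow_s18 hc hc']
  exact (h.pow r).mul_left' c

theorem descending_modEq_of_le {f : ℕ → ℕ → ℕ}
    (hstep : ∀ k n, 10 ≤ k → k < n → f k n = dungeon k (f (k + 1) n))
    {a b m n M : ℕ} (ha : 10 ≤ a) (hab : a ≤ b) (hm : b ≤ m)
    (hn : b ≤ n) (h : f b m ≡ f b n [MOD M]) : f a m ≡ f a n [MOD M] := by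
  induction b, hab using Nat.le_induction with
  | base => exact h
  | succ b hab ih =>
    refine ih (by omega) (by omega) ?_
    rw [hstep b m (by omega) (by omega), hstep b n (by omega) (by omega)]
    exact dungeon_modEq b h

theorem descending_ten_pow_modEq {f : ℕ → ℕ → ℕ}
    (hstep : ∀ k n, 10 ≤ k → k < n → f k n = dungeon k (f (k + 1) n))
    (j : ℕ) : ∀ {r m n : ℕ}, 1 ≤ r → 10 ^ (r + j) ≤ m →
    10 ^ (r + j) ≤ n → f (10 ^ r) m ≡ f (10 ^ r) n [MOD 10 ^ j] := by
  induction j with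
  | zero => intro r m n _ _ _; simpa using Nat.modEq_one
  | succ j ih =>
    intro r m n hr hm hn
    have hr10 : 10 ≤ 10 ^ r := Nat.le_self_pow (by omega) 10
    have hsucc : 10 ^ (r + 1) = 10 * 10 ^ r := pow_succ' 10 r
    have hle : 10 ^ (r + 1) ≤ 10 ^ (r + (j + 1)) := Nat.pow_le_pow_right (by norm_num) (by omega)
    have hadd : r + 1 + j = r + (j + 1) := by omega
    have top : f (10 ^ (r + 1)) m ≡ f (10 ^ (r + 1)) n [MOD 10 ^ j] :=
      ih (by omega) (by rwa [hadd]) (by rwa [hadd])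
    have five : f (5 * 10 ^ r) m ≡ f (5 * 10 ^ r) n [MOD 5 * 10 ^ j] := by
      rw [hstep _ m (by omega) (by omega), hstep _ n (by omega) (by omega)]
      exact dungeon_mul_ten_pow_modEq (by norm_num) (by norm_num) r
        (descending_modEq_of_le hstep (by omega) (by omega) (by omega) (by omega) top)
    have two : f (2 * 10 ^ r) m ≡ f (2 * 10 ^ r) n [MOD 2 * (5 * 10 ^ j)] := by
      rw [hstep _ m (by omega) (by omega), hstep _ n (by omega) (by omega)]
      exact dungeon_mul_ten_pow_modEq (by norm_num) (by norm_num) r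
        (descending_modEq_of_le hstep (by omega) (by omega) (by omega) (by omega) five)
    have hmod : 10 ^ (j + 1) = 2 * (5 * 10 ^ j) := by ring
    rw [hmod]
    exact descending_modEq_of_le hstep hr10 (by omega) (by omega) (by omega) two

theorem alpha_tendsto_10adic (f : ℕ → ℕ → ℕ) (α : ℕ → ℕ)
    (hdiag : ∀ n, f n n = n)
    (hstep : ∀ k n, 10 ≤ k → k < n → f k n = dungeon k (f (k + 1) n))
    (hα : ∀ n, 10 ≤ n → α n = f 10 n) :
    ∀ k : ℕ, ∃ N : ℕ, ∀ m n : ℕ, N ≤ m → N ≤ n → α m ≡ α n [MOD 10 ^ k] := by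
  intro k
  refine ⟨10 ^ (1 + k), fun m n hm hn => ?_⟩
  have h10 : 10 ≤ 10 ^ (1 + k) := Nat.le_self_pow (by omega) 10
  rw [hα m (h10.trans hm), hα n (h10.trans hn)]
  simpa using descending_ten_pow_modEq hstep k le_rfl hm hn
end
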